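/- Let n ≥ 0 and let (u_j(t))_{j≥1} be a solution of the Sabra shell model whose forcing satisfies Φ_n < ∞. Then H_n satisfies the ladder inequality (1/2) dH_n/dt ≤ −(ν/2) H_{n+1} + (d_n/ν) H_n sup_j |u_j|² + H_n^{1/2} Φ_n^{1/2}, where d_n = c_n²/(2λ⁴) and c_n = λ^{−n+1}(|a|λ^{−2n} + |b| + |a+b|λ^{2n}). -/

import Mathlib

open Filter MeasureTheory
open scoped BigOperators Topology

noncomputable section

/-- Logarithmically spaced wavenumbers `k_j = k₀ λ^j`. -/
def wk (k₀ lam : ℝ) (j : ℕ) : ℝ := k₀ * lam ^ j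

/-- Sabra forcing `f_j = F φ_{j - j_f}` (with the convention `φ_p = 0` for `p < 0`). -/
def sabraForcing (F : ℂ) (φ : ℕ → ℂ) (jf j : ℕ) : ℂ :=
  if jf ≤ j then F * φ (j - jf) else 0

/-- Right-hand side of the Sabra shell model
`i(a k_{j+1} u*_{j+1} u_{j+2} + b k_j u_{j+1} u*_{j-1} - c k_{j-1} u_{j-1} u_{j-2}) - ν k_j² u_j + f_j`. -/
def sabraRHS (a b c ν k₀ lam : ℝ) (f : ℕ → ℂ) (v : ℕ → ℂ) (j : ℕ) : ℂ :=
  Complex.I * (((a * wk k₀ lam (j+1) : ℝ) : ℂ) * (starRingEnd ℂ) (v (j+1)) * v (j+2)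
      + ((b * wk k₀ lam j : ℝ) : ℂ) * v (j+1) * (starRingEnd ℂ) (v (j-1))
      - ((c * wk k₀ lam (j-1) : ℝ) : ℂ) * v (j-1) * v (j-2))
    - ((ν * (wk k₀ lam j)^2 : ℝ) : ℂ) * v j + f j

/-- `u` is a solution of the Sabra shell model on the time set `s`
(the boundary conditions `u_0 = u_{-1} = 0` are encoded by `u 0 t = 0` together with
truncated subtraction on the indices). -/
def IsSabraSolution (a b c ν k₀ lam : ℝ) (f : ℕ → ℂ) (u : ℕ → ℝ → ℂ) (s : Set ℝ) : Prop :=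
  (∀ t : ℝ, u 0 t = 0) ∧
  ∀ j : ℕ, 1 ≤ j → ∀ t ∈ s,
    HasDerivAt (fun τ => u j τ) (sabraRHS a b c ν k₀ lam f (fun i => u i t) j) t

/-- Energy `E(t) = Σ_{j≥1} |u_j(t)|²`. -/
def sEnergy (u : ℕ → ℝ → ℂ) (t : ℝ) : ℝ := ∑' j : ℕ, ‖u (j+1) t‖^2

/-- `H_n = Σ_{j≥1} k_j^{2n} |v_j|²`. -/
def HnS (k₀ lam : ℝ) (n : ℕ) (v : ℕ → ℂ) : ℝ :=
  ∑' j : ℕ, (wk k₀ lam (j+1))^(2*n) * ‖v (j+1)‖^2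

/-- `H_{n,m} = Σ_{j≥1} k_j^{2nm} |v_j|^{2m}`. -/
def HnmS (k₀ lam : ℝ) (n m : ℕ) (v : ℕ → ℂ) : ℝ :=
  ∑' j : ℕ, (wk k₀ lam (j+1))^(2*n*m) * ‖v (j+1)‖^(2*m)

/-- `Φ_n = Σ_{j≥1} k_j^{2n} |f_j|²`. -/
def PhinS (k₀ lam : ℝ) (n : ℕ) (f : ℕ → ℂ) : ℝ :=
  ∑' j : ℕ, (wk k₀ lam (j+1))^(2*n) * ‖f (j+1)‖^2

/-- Time average `⟨g⟩ = T⁻¹ ∫_0^T g dt`. -/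
def timeAvg (T : ℝ) (g : ℝ → ℝ) : ℝ := T⁻¹ * ∫ t in (0:ℝ)..T, g t

/-- `C_γ = Σ_{p≥0} λ^{2γp} |φ_p|²`. -/
def CgS (lam γ : ℝ) (φ : ℕ → ℂ) : ℝ := ∑' p : ℕ, lam ^ (2*γ*(p:ℝ)) * ‖φ p‖^2

/-- `B_γ = sup_{p≥0} λ^{-(2γ-1)p} |φ_p|`. -/
def BgS (lam γ : ℝ) (φ : ℕ → ℂ) : ℝ := ⨆ p : ℕ, lam ^ (-(2*γ-1)*(p:ℝ)) * ‖φ p‖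

/-- `A = |a|λ + |b| + |a+b|λ⁻¹`. -/
def AconstS (a b lam : ℝ) : ℝ := |a| * lam + |b| + |a + b| * lam⁻¹

/-- `c_n = λ^{-n+1}(|a|λ^{-2n} + |b| + |a+b|λ^{2n})`. -/
def cnS (a b lam : ℝ) (n : ℕ) : ℝ :=
  lam ^ (1 - (n:ℤ)) * (|a| * lam ^ (-(2*(n:ℤ))) + |b| + |a + b| * lam ^ (2*(n:ℤ)))

/-- `d_n = c_n²/(2λ⁴)`. -/
def dnS (a b lam : ℝ) (n : ℕ) : ℝ := (cnS a b lam n)^2 / (2 * lam^4)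

/-- `U = ⟨E⟩^{1/2}` over `[0,T]`. -/
def Uavg (u : ℕ → ℝ → ℂ) (T : ℝ) : ℝ := Real.sqrt (timeAvg T (sEnergy u))

/-- Reynolds number `Re = U/(ν k_f)` over `[0,T]`. -/
def ReynoldsNum (u : ℕ → ℝ → ℂ) (T ν kf : ℝ) : ℝ := Uavg u T / (ν * kf)

/-- Time-averaged energy-dissipation rate `ε = ν ⟨Σ_j k_j² |u_j|²⟩` over `[0,T]`. -/
def epsAvg (k₀ lam ν : ℝ) (u : ℕ → ℝ → ℂ) (T : ℝ) : ℝ :=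
  ν * timeAvg T (fun t => HnS k₀ lam 1 (fun j => u j t))

lemma wk_pos {k₀ lam : ℝ} (hk₀ : 0 < k₀) (hlam : 1 < lam) (j : ℕ) : 0 < wk k₀ lam j := by
  unfold wk; positivity

lemma wk_succ (k₀ lam : ℝ) (j : ℕ) : wk k₀ lam (j+1) = lam * wk k₀ lam j := by
  unfold wk; ring

lemma wk_ge {k₀ lam : ℝ} (hk₀ : 0 < k₀) (hlam : 1 < lam) (j : ℕ) : k₀ ≤ wk k₀ lam j := by
  unfold wk
  have := one_le_pow₀ hlam.le (n := j)
  nlinarith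

lemma sumT_le {k₀ lam : ℝ} (hk₀ : 0 < k₀) (hlam : 1 < lam) (n N : ℕ) (w : ℕ → ℝ)
    (hw : ∀ j, 0 ≤ w j) (M H η : ℝ) (hM : ∀ j, w j ≤ M)
    (hH : ∑ j ∈ Finset.range (N+2), wk k₀ lam (j+1) ^ (2*n) * w (j+1) ^ 2 ≤ H)
    (hη : ∀ j, N ≤ j → wk k₀ lam (j+1) ^ n * w (j+1) ≤ η) :
    ∑ j ∈ Finset.range (N+2), wk k₀ lam (j+2) ^ (2*n+1) * (w (j+1) * w (j+2) * w (j+3)) ≤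
      M * √(∑ j ∈ Finset.range (N+2), wk k₀ lam (j+1) ^ (2*(n+1)) * w (j+1) ^ 2) *
        ((lam ^ (n+1))⁻¹ * √H + 2 * lam ^ (n+1) * η) := by
  have hl : 0 < lam := by linarith
  set P := ∑ j ∈ Finset.range (N+2), wk k₀ lam (j+1) ^ (2*(n+1)) * w (j+1) ^ 2 with hP
  have hM0 : 0 ≤ M := (hw 0).trans (hM 0)
  have hk := fun j => (wk_pos hk₀ hlam j)
  set x : ℕ → ℝ := fun j => wk k₀ lam j ^ n * w j with hx
  set y : ℕ → ℝ := fun j => wk k₀ lam j ^ (n+1) * w j with hy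
  have hx0 : ∀ j, 0 ≤ x j := fun j => mul_nonneg (pow_nonneg (hk j).le _) (hw j)
  have hy0 : ∀ j, 0 ≤ y j := fun j => mul_nonneg (pow_nonneg (hk j).le _) (hw j)
  have hxs : ∑ j ∈ Finset.range (N+2), x (j+1) ^ 2 ≤ H := by
    refine le_trans (le_of_eq (Finset.sum_congr rfl fun j _ => ?_)) hH
    simp only [hx]; ring
  have hys : ∑ j ∈ Finset.range (N+2), y (j+1) ^ 2 = P := by
    refine Finset.sum_congr rfl fun j _ => ?_
    simp only [hy]; ring
  have hyP : ∀ j, j < N+2 → y (j+1) ≤ √P := by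
    intro j hj
    apply Real.le_sqrt_of_sq_le
    rw [← hys]
    exact Finset.single_le_sum (f := fun j => y (j+1)^2) (fun i _ => sq_nonneg _)
      (Finset.mem_range.2 hj)
  have hb : ∀ j, N ≤ j → j < N+2 →
      wk k₀ lam (j+2) ^ (2*n+1) * (w (j+1) * w (j+2) * w (j+3)) ≤ M * √P * (lam^(n+1) * η) := by
    intro j hj1 hj2
    have e : wk k₀ lam (j+2) ^ (2*n+1) * (w (j+1) * w (j+2) * w (j+3))
        = w (j+3) * y (j+1) * (lam^(n+1) * x (j+2)) := by
      simp only [hx, hy, wk_succ k₀ lam (j+1)]; ring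
    rw [e]
    have h1 := hη (j+1) (by omega)
    have h2 := hyP j hj2
    have h3 := hM (j+3)
    have := hy0 (j+1); have := hx0 (j+2); have := hw (j+3)
    gcongr
  have hmain : ∑ j ∈ Finset.range N, wk k₀ lam (j+2) ^ (2*n+1) * (w (j+1) * w (j+2) * w (j+3)) ≤
      M * √P * ((lam ^ (n+1))⁻¹ * √H) := by
    calc _ ≤ ∑ j ∈ Finset.range N, (M * (lam^(n+1))⁻¹) * (x (j+2) * y (j+3)) := by
            refine Finset.sum_le_sum fun j _ => ?_
            have e : wk k₀ lam (j+2) ^ (2*n+1) * (w (j+1) * w (j+2) * w (j+3))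
                = (w (j+1) * (lam^(n+1))⁻¹) * (x (j+2) * y (j+3)) := by
              simp only [hx, hy, wk_succ k₀ lam (j+2)]
              field_simp
              ring
            rw [e]
            have h3 := hM (j+1)
            have := hy0 (j+3); have := hx0 (j+2); have := hw (j+1)
            gcongr
      _ = (M * (lam^(n+1))⁻¹) * ∑ j ∈ Finset.range N, (x (j+2) * y (j+3)) := by
            rw [Finset.mul_sum]
      _ ≤ (M * (lam^(n+1))⁻¹) * (√H * √P) := by
            have h1 : ∑ j ∈ Finset.range N, x (j+2) ^ 2 ≤ H := by
              refine le_trans ?_ hxs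
              rw [Finset.sum_range_succ', Finset.sum_range_succ]
              have := sq_nonneg (x (0+1)); have := sq_nonneg (x (N+1+1))
              have e : ∀ j, x (j+1+1) = x (j+2) := fun _ => rfl
              simp only [e]
              linarith
            have h2 : ∑ j ∈ Finset.range N, y (j+3) ^ 2 ≤ P := by
              rw [← hys, Finset.sum_range_succ', Finset.sum_range_succ']
              have := sq_nonneg (y (0+1)); have := sq_nonneg (y (0+1+1))
              have e : ∀ j, y (j+1+1+1) = y (j+3) := fun _ => rfl
              simp only [e]
              linarith
            have := Real.sum_mul_le_sqrt_mul_sqrt (Finset.range N) (fun j => x (j+2)) (fun j => y (j+3))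
            have h3 := Real.sqrt_le_sqrt h1
            have h4 := Real.sqrt_le_sqrt h2
            have h5 : √(∑ j ∈ Finset.range N, x (j+2) ^ 2) * √(∑ j ∈ Finset.range N, y (j+3) ^ 2)
              ≤ √H * √P := by gcongr
            exact mul_le_mul_of_nonneg_left (this.trans h5) (by positivity)
      _ = _ := by ring
  rw [Finset.sum_range_succ, Finset.sum_range_succ]
  have h1 := hb N le_rfl (by omega)
  have h2 := hb (N+1) (by omega) (by omega)
  linarith

/-- pointwise bound of one term -/
lemma term_le (a b c ν k₀ lam : ℝ) (hk₀ : 0 < k₀) (hlam : 1 < lam) (f v : ℕ → ℂ) (h0 : v 0 = 0)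
    (n j : ℕ) :
    wk k₀ lam (j+1) ^ (2*n) * ((starRingEnd ℂ) (v (j+1)) * sabraRHS a b c ν k₀ lam f v (j+1)).re ≤
      - ν * (wk k₀ lam (j+1) ^ (2*(n+1)) * ‖v (j+1)‖^2)
      + (wk k₀ lam (j+1) ^ n * ‖v (j+1)‖) * (wk k₀ lam (j+1) ^ n * ‖f (j+1)‖)
      + (|a| * (lam^(2*n))⁻¹ * (wk k₀ lam (j+2) ^ (2*n+1) * (‖v (j+1)‖ * ‖v (j+2)‖ * ‖v (j+3)‖))
        + |b| * (wk k₀ lam (j+1) ^ (2*n+1) * (‖v j‖ * ‖v (j+1)‖ * ‖v (j+2)‖))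
        + |c| * lam^(2*n) * (wk k₀ lam (j-1+1) ^ (2*n+1) * (‖v (j-1)‖ * ‖v (j-1+1)‖ * ‖v (j-1+2)‖))) := by
  have hl : 0 < lam := by linarith
  have hk := fun j => (wk_pos hk₀ hlam j)
  set A : ℂ := ((a * wk k₀ lam (j+2) : ℝ) : ℂ) * (starRingEnd ℂ) (v (j+2)) * v (j+3) with hA
  set B : ℂ := ((b * wk k₀ lam (j+1) : ℝ) : ℂ) * v (j+2) * (starRingEnd ℂ) (v j) with hB
  set C : ℂ := ((c * wk k₀ lam j : ℝ) : ℂ) * v j * v (j-1) with hC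
  have e : sabraRHS a b c ν k₀ lam f v (j+1) = Complex.I * (A + B - C)
     - ((ν * (wk k₀ lam (j+1))^2 : ℝ) : ℂ) * v (j+1) + f (j+1) := rfl
  have e2 : ((starRingEnd ℂ) (v (j+1)) * sabraRHS a b c ν k₀ lam f v (j+1)).re
      = ((starRingEnd ℂ) (v (j+1)) * (Complex.I * (A + B - C))).re
        - ν * (wk k₀ lam (j+1))^2 * ‖v (j+1)‖^2 + ((starRingEnd ℂ) (v (j+1)) * f (j+1)).re := by
    rw [e, mul_add, mul_sub, Complex.add_re, Complex.sub_re]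
    congr 2
    rw [mul_left_comm, Complex.re_ofReal_mul, ← Complex.normSq_eq_conj_mul_self, Complex.ofReal_re,
      Complex.normSq_eq_norm_sq]
  have hf : ((starRingEnd ℂ) (v (j+1)) * f (j+1)).re ≤ ‖v (j+1)‖ * ‖f (j+1)‖ := by
    refine (Complex.re_le_norm _).trans ?_
    rw [norm_mul, Complex.norm_conj]
  have hn : ((starRingEnd ℂ) (v (j+1)) * (Complex.I * (A + B - C))).re ≤
      ‖v (j+1)‖ * (|a| * wk k₀ lam (j+2) * ‖v (j+2)‖ * ‖v (j+3)‖
        + |b| * wk k₀ lam (j+1) * ‖v (j+2)‖ * ‖v j‖ + |c| * wk k₀ lam j * ‖v j‖ * ‖v (j-1)‖) := by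
    refine (Complex.re_le_norm _).trans ?_
    rw [norm_mul, Complex.norm_conj, norm_mul, Complex.norm_I, one_mul]
    gcongr
    refine (norm_sub_le _ _).trans (add_le_add ((norm_add_le _ _).trans (le_of_eq ?_)) (le_of_eq ?_))
    · simp [hA, hB, abs_of_pos (hk _)]
    · simp [hC, abs_of_pos (hk _)]
  rw [e2]
  have hc : wk k₀ lam (j+1) ^ (2*n) * (‖v (j+1)‖ * (|c| * wk k₀ lam j * ‖v j‖ * ‖v (j-1)‖)) =
     |c| * lam^(2*n) * (wk k₀ lam (j-1+1) ^ (2*n+1) * (‖v (j-1)‖ * ‖v (j-1+1)‖ * ‖v (j-1+2)‖)) := by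
    rcases j with _ | j
    · simp [h0]
    · simp only [Nat.add_sub_cancel, wk_succ k₀ lam (j+1)]; ring
  have ha : wk k₀ lam (j+1) ^ (2*n) * (‖v (j+1)‖ * (|a| * wk k₀ lam (j+2) * ‖v (j+2)‖ * ‖v (j+3)‖)) =
     |a| * (lam^(2*n))⁻¹ * (wk k₀ lam (j+2) ^ (2*n+1) * (‖v (j+1)‖ * ‖v (j+2)‖ * ‖v (j+3)‖)) := by
    rw [pow_succ (wk k₀ lam (j+2)), wk_succ k₀ lam (j+1), mul_pow lam _ (2*n)]
    field_simp
  rw [← hc, ← ha]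
  have := mul_le_mul_of_nonneg_left (add_le_add hf hn) (pow_nonneg (hk (j+1)).le (2*n))
  have e3 : wk k₀ lam (j+1) ^ (2*n) * (ν * (wk k₀ lam (j+1))^2 * ‖v (j+1)‖^2) =
    ν * (wk k₀ lam (j+1) ^ (2*(n+1)) * ‖v (j+1)‖^2) := by ring
  have e4 : wk k₀ lam (j+1) ^ (2*n) * (‖v (j+1)‖ * ‖f (j+1)‖) =
    (wk k₀ lam (j+1) ^ n * ‖v (j+1)‖) * (wk k₀ lam (j+1) ^ n * ‖f (j+1)‖) := by ring
  have e5 : wk k₀ lam (j+1) ^ (2*n) * (‖v (j+1)‖ * (|b| * wk k₀ lam (j+1) * ‖v (j+2)‖ * ‖v j‖)) =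
    |b| * (wk k₀ lam (j+1) ^ (2*n+1) * (‖v j‖ * ‖v (j+1)‖ * ‖v (j+2)‖)) := by ring
  linarith

lemma trunc_le (a b c ν k₀ lam : ℝ) (hν : 0 < ν) (hk₀ : 0 < k₀) (hlam : 1 < lam) (f v : ℕ → ℂ)
    (h0 : v 0 = 0) (n N : ℕ) (M H η Φ : ℝ) (hM : ∀ j, ‖v j‖ ≤ M)
    (hH : ∑ j ∈ Finset.range (N+2), wk k₀ lam (j+1) ^ (2*n) * ‖v (j+1)‖ ^ 2 ≤ H)
    (hF : ∑ j ∈ Finset.range (N+2), wk k₀ lam (j+1) ^ (2*n) * ‖f (j+1)‖ ^ 2 ≤ Φ)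
    (hη : ∀ j, N ≤ j → wk k₀ lam (j+1) ^ n * ‖v (j+1)‖ ≤ η) :
    ∑ j ∈ Finset.range (N+2), wk k₀ lam (j+1) ^ (2*n) *
        ((starRingEnd ℂ) (v (j+1)) * sabraRHS a b c ν k₀ lam f v (j+1)).re ≤
      - (ν/2) * (∑ j ∈ Finset.range (N+2), wk k₀ lam (j+1) ^ (2*(n+1)) * ‖v (j+1)‖ ^ 2)
      + ((|a| * (lam^(2*n))⁻¹ + |b| + |c| * lam^(2*n)) *
          (M * ((lam ^ (n+1))⁻¹ * √H + 2 * lam ^ (n+1) * η)))^2 / (2 * ν) + √H * √Φ := by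
  have hl : 0 < lam := by linarith
  have hk := fun j => (wk_pos hk₀ hlam j)
  have hT := sumT_le hk₀ hlam n N (fun j => ‖v j‖) (fun j => norm_nonneg _) M H η hM hH hη
  set P := ∑ j ∈ Finset.range (N+2), wk k₀ lam (j+1) ^ (2*(n+1)) * ‖v (j+1)‖ ^ 2 with hP
  have hP0 : 0 ≤ P := Finset.sum_nonneg fun j _ =>
    mul_nonneg (pow_nonneg (hk _).le _) (sq_nonneg _)
  refine (Finset.sum_le_sum fun j _ => term_le a b c ν k₀ lam hk₀ hlam f v h0 n j).trans ?_
  set T : ℕ → ℝ := fun j => wk k₀ lam (j+1) ^ (2*n+1) * (‖v j‖ * ‖v (j+1)‖ * ‖v (j+2)‖) with hTd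
  have hT0 : ∀ j, 0 ≤ T j := fun j => mul_nonneg (pow_nonneg (hk _).le _) (by positivity)
  have hTz : T 0 = 0 := by simp [hTd, h0]
  have eT : ∀ j, wk k₀ lam (j+2) ^ (2*n+1) * (‖v (j+1)‖ * ‖v (j+2)‖ * ‖v (j+3)‖) = T (j+1) :=
    fun _ => rfl
  simp only [eT] at hT
  have eT1 : ∀ j, wk k₀ lam (j-1+1) ^ (2*n+1) * (‖v (j-1)‖ * ‖v (j-1+1)‖ * ‖v (j-1+2)‖) = T (j-1) :=
    fun _ => rfl
  have eT2 : ∀ j, wk k₀ lam (j+1) ^ (2*n+1) * (‖v j‖ * ‖v (j+1)‖ * ‖v (j+2)‖) = T j :=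
    fun _ => rfl
  simp only [eT, eT1, eT2, Finset.sum_add_distrib, ← Finset.mul_sum]
  set S := ∑ j ∈ Finset.range (N+2), T (j+1) with hS
  have s1 : ∑ j ∈ Finset.range (N+2), T j ≤ S := by
    rw [Finset.sum_range_succ', hS, Finset.sum_range_succ _ (N+1), hTz]
    linarith [hT0 (N+1+1)]
  have s2 : ∑ j ∈ Finset.range (N+2), T (j-1) ≤ S := by
    rw [Finset.sum_range_succ']
    simp only [Nat.add_sub_cancel, Nat.zero_sub, hTz, add_zero]
    refine le_trans ?_ s1
    rw [Finset.sum_range_succ _ (N+1)]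
    linarith [hT0 (N+1)]
  have hfs : ∑ j ∈ Finset.range (N+2), (wk k₀ lam (j+1) ^ n * ‖v (j+1)‖) * (wk k₀ lam (j+1) ^ n * ‖f (j+1)‖)
      ≤ √H * √Φ := by
    refine (Real.sum_mul_le_sqrt_mul_sqrt _ _ _).trans ?_
    gcongr
    · refine le_trans (le_of_eq (Finset.sum_congr rfl fun j _ => ?_)) hH
      ring
    · refine le_trans (le_of_eq (Finset.sum_congr rfl fun j _ => ?_)) hF
      ring
  set Q := ((lam ^ (n+1))⁻¹ * √H + 2 * lam ^ (n+1) * η)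
  set A := |a| * (lam^(2*n))⁻¹ + |b| + |c| * lam^(2*n) with hA
  have hA0 : 0 ≤ A := by positivity
  have hAS : |a| * (lam^(2*n))⁻¹ * S + |b| * ∑ j ∈ Finset.range (N+2), T j +
      |c| * lam^(2*n) * ∑ j ∈ Finset.range (N+2), T (j-1) ≤ A * S := by
    have h1 := mul_le_mul_of_nonneg_left s1 (abs_nonneg b)
    have h2 := mul_le_mul_of_nonneg_left s2 (by positivity : 0 ≤ |c| * lam^(2*n))
    rw [hA]; linarith
  have hAT := mul_le_mul_of_nonneg_left hT hA0
  have hY : A * (M * √P * Q) ≤ ν/2 * P + (A * (M * Q))^2/(2*ν) := by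
    have hs := Real.sq_sqrt hP0
    have : 0 ≤ (ν * √P - A*(M*Q))^2 / (2*ν) := by positivity
    have e : (ν * √P - A*(M*Q))^2 / (2*ν) = ν/2 * (√P)^2 - A * (M * √P * Q) + (A * (M * Q))^2/(2*ν) := by
      field_simp; ring
    rw [e, hs] at this
    linarith
  linarith

lemma deriv_bound (a b c ν k₀ lam : ℝ)
    (hν : 0 < ν) (hk₀ : 0 < k₀) (hlam : 1 < lam)
    (n : ℕ) (f : ℕ → ℂ)
    (hΦ : Summable (fun j : ℕ => (wk k₀ lam (j+1))^(2*n) * ‖f (j+1)‖^2))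
    (u : ℕ → ℝ → ℂ)
    (hsol : IsSabraSolution a b c ν k₀ lam f u Set.univ)
    (t : ℝ) (D : ℝ)
    (hD : HasDerivAt (fun τ => HnS k₀ lam n (fun j => u j τ)) D t)
    (hpos : 0 < HnS k₀ lam n (fun j => u j t)) (m : ℝ) (hm : ∀ j, ‖u j t‖ ≤ m)
    (K : ℕ) (ε : ℝ) (hε : 0 < ε) :
    (1/2) * D ≤
      - (ν/2) * ((∑ j ∈ Finset.range K, wk k₀ lam (j+1) ^ (2*(n+1)) * ‖u (j+1) t‖ ^ 2) - ε)
      + ((|a| * (lam^(2*n))⁻¹ + |b| + |c| * lam^(2*n)) *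
          ((m + ε + ε / k₀^n) * ((lam ^ (n+1))⁻¹ * √(HnS k₀ lam n (fun j => u j t) + ε)
            + 2 * lam ^ (n+1) * ε)))^2 / (2 * ν)
      + √(HnS k₀ lam n (fun j => u j t) + ε) * √(PhinS k₀ lam n f) := by
  have hl : 0 < lam := by linarith
  have hk := fun j => (wk_pos hk₀ hlam j)
  obtain ⟨hu0, hu⟩ := hsol
  have hcont : ∀ j, ContinuousAt (u j) t := by
    intro j
    rcases j with _ | j
    · have : u 0 = fun _ => 0 := funext hu0
      rw [this]; exact continuousAt_const
    · exact (hu (j+1) (by omega) t trivial).continuousAt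
  set F : ℝ → ℝ := fun τ => HnS k₀ lam n (fun j => u j τ) with hF
  set g : ℕ → ℝ → ℝ := fun j τ => wk k₀ lam (j+1) ^ (2*n) * ‖u (j+1) τ‖^2 with hg
  have hg0 : ∀ j τ, 0 ≤ g j τ := fun j τ => mul_nonneg (pow_nonneg (hk _).le _) (sq_nonneg _)
  have hFg : ∀ τ, F τ = ∑' j, g j τ := fun τ => rfl
  have hsum : ∀ τ, 0 < F τ → Summable (fun j => g j τ) := by
    intro τ h
    by_contra hc
    rw [hFg, tsum_eq_zero_of_not_summable hc] at h
    exact lt_irrefl _ h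
  have hFc : ContinuousAt F t := hD.continuousAt
  have hgc : ∀ j, ContinuousAt (g j) t := fun j =>
    continuousAt_const.mul ((hcont (j+1)).norm.pow 2)
  have hGc : ∀ N, ContinuousAt (fun τ => ∑ j ∈ Finset.range N, g j τ) t := fun N =>
    tendsto_finsetSum _ fun j _ => hgc j
  -- tail
  obtain ⟨N0, hN0⟩ : ∃ N0, F t - ∑ j ∈ Finset.range N0, g j t < ε^2 := by
    have h1 := (hsum t hpos).hasSum.tendsto_sum_nat
    rw [← hFg] at h1
    have h2 : F t - ε^2 < F t := by have := pow_pos hε 2; linarith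
    obtain ⟨N, hN⟩ := (h1.eventually (lt_mem_nhds h2)).exists
    exact ⟨N, by linarith⟩
  have ev1 : ∀ᶠ τ in 𝓝 t, 0 < F τ := hFc.eventually (lt_mem_nhds hpos)
  have ev2 : ∀ᶠ τ in 𝓝 t, F τ - ∑ j ∈ Finset.range N0, g j τ < ε^2 :=
    (hFc.sub (hGc N0)).eventually (gt_mem_nhds hN0)
  have ev3 : ∀ᶠ τ in 𝓝 t, F τ < F t + ε := hFc.eventually (gt_mem_nhds (by linarith))
  have ev4 : ∀ᶠ τ in 𝓝 t,
      (∑ j ∈ Finset.range K, wk k₀ lam (j+1) ^ (2*(n+1)) * ‖u (j+1) t‖ ^ 2) - ε <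
      ∑ j ∈ Finset.range K, wk k₀ lam (j+1) ^ (2*(n+1)) * ‖u (j+1) τ‖ ^ 2 := by
    have : ContinuousAt (fun τ => ∑ j ∈ Finset.range K,
        wk k₀ lam (j+1) ^ (2*(n+1)) * ‖u (j+1) τ‖ ^ 2) t :=
      tendsto_finsetSum _ fun j _ => continuousAt_const.mul ((hcont (j+1)).norm.pow 2)
    exact this.eventually (lt_mem_nhds (by linarith))
  have ev5 : ∀ᶠ τ in 𝓝 t, ∀ j ∈ Finset.range (N0+1), ‖u j τ‖ < m + ε := by
    rw [Filter.eventually_all_finset]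
    intro j _
    exact (hcont j).norm.eventually (gt_mem_nhds (by linarith [hm j]))
  set Rr := - (ν/2) * ((∑ j ∈ Finset.range K, wk k₀ lam (j+1) ^ (2*(n+1)) * ‖u (j+1) t‖ ^ 2) - ε)
      + ((|a| * (lam^(2*n))⁻¹ + |b| + |c| * lam^(2*n)) *
          ((m + ε + ε / k₀^n) * ((lam ^ (n+1))⁻¹ * √(F t + ε) + 2 * lam ^ (n+1) * ε)))^2 / (2 * ν)
      + √(F t + ε) * √(PhinS k₀ lam n f) with hRr
  have evall := ev1.and (ev2.and (ev3.and (ev4.and ev5)))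
  -- derivative of truncated sums
  have hder : ∀ N τ, HasDerivAt (fun τ => ∑ j ∈ Finset.range N, g j τ)
      (2 * ∑ j ∈ Finset.range N, wk k₀ lam (j+1) ^ (2*n) *
        ((starRingEnd ℂ) (u (j+1) τ) * sabraRHS a b c ν k₀ lam f (fun i => u i τ) (j+1)).re) τ := by
    intro N τ
    rw [Finset.mul_sum]
    apply HasDerivAt.fun_sum
    intro j _
    have := ((hu (j+1) (by omega) τ trivial).norm_sq).const_mul (wk k₀ lam (j+1) ^ (2*n))
    refine this.congr_deriv ?_
    rw [Complex.inner]
    ring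
  have key : ∀ᶠ τ in 𝓝 t, 0 < F τ ∧ ∀ N, max K N0 ≤ N →
      deriv (fun τ => ∑ j ∈ Finset.range (N+2), g j τ) τ ≤ 2 * Rr := by
    filter_upwards [evall] with τ ⟨h1, h2, h3, h4, h5⟩
    refine ⟨h1, fun N hN => ?_⟩
    have hs := hsum τ h1
    have hη : ∀ j, N0 ≤ j → wk k₀ lam (j+1) ^ n * ‖u (j+1) τ‖ ≤ ε := by
      intro j hj
      refine (sq_le_sq₀ (mul_nonneg (pow_nonneg (hk _).le _) (norm_nonneg _)) hε.le).1 ?_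
      have h6 : g j τ + ∑ i ∈ Finset.range N0, g i τ ≤ F τ := by
        rw [← Finset.sum_insert (f := fun i => g i τ) (by simp [hj])]
        exact hs.sum_le_tsum _ (fun i _ => hg0 i τ)
      have h7 : (wk k₀ lam (j+1) ^ n * ‖u (j+1) τ‖)^2 = g j τ := by simp only [hg]; ring
      rw [h7]; linarith
    have hM : ∀ j, ‖u j τ‖ ≤ m + ε + ε / k₀^n := by
      intro j
      by_cases hj : j < N0 + 1
      · have := h5 j (Finset.mem_range.2 hj)
        have : 0 ≤ ε / k₀^n := by positivity
        linarith
      · obtain ⟨i, rfl⟩ : ∃ i, j = i + 1 := ⟨j-1, by omega⟩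
        have h6 := hη i (by omega)
        have h7 : k₀ ^ n ≤ wk k₀ lam (i+1) ^ n := by
          gcongr; exact wk_ge hk₀ hlam _
        have h8 : ‖u (i+1) τ‖ ≤ ε / k₀^n := by
          rw [le_div_iff₀ (by positivity)]
          have := mul_le_mul_of_nonneg_right h7 (norm_nonneg (u (i+1) τ))
          linarith
        have := (norm_nonneg _).trans (hm 0)
        linarith
    have hmain := trunc_le a b c ν k₀ lam hν hk₀ hlam f (fun i => u i τ) (hu0 τ) n N
      (m + ε + ε / k₀^n) (F t + ε) ε (PhinS k₀ lam n f) hM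
      ((hs.sum_le_tsum _ (fun i _ => hg0 i τ)).trans h3.le)
      (hΦ.sum_le_tsum _ (fun i _ => mul_nonneg (pow_nonneg (hk _).le _) (sq_nonneg _)))
      (fun j hj => hη j ((le_max_right K N0).trans (hN.trans hj)))
    rw [(hder (N+2) τ).deriv]
    have hKN : ∑ j ∈ Finset.range K, wk k₀ lam (j+1) ^ (2*(n+1)) * ‖u (j+1) τ‖ ^ 2 ≤
        ∑ j ∈ Finset.range (N+2), wk k₀ lam (j+1) ^ (2*(n+1)) * ‖u (j+1) τ‖ ^ 2 := by
      apply Finset.sum_le_sum_of_subset_of_nonneg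
      · apply Finset.range_mono
        have := le_max_left K N0
        show K ≤ N + 2
        omega
      · exact fun i _ _ => mul_nonneg (pow_nonneg (hk _).le _) (sq_nonneg _)
    have h9 := mul_le_mul_of_nonneg_left (h4.le.trans hKN) (by positivity : 0 ≤ ν/2)
    rw [hRr]
    linarith
  obtain ⟨δ, hδ, hball⟩ := Metric.eventually_nhds_iff.1 key
  have hinc : ∀ h, 0 < h → h < δ → F (t+h) - F t ≤ 2 * Rr * h := by
    intro h hh0 hhδ
    have hin : ∀ x ∈ Set.Icc t (t+h), dist x t < δ := by
      intro x hx
      rw [Real.dist_eq, abs_lt]; constructor <;> linarith [hx.1, hx.2]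
    have hN : ∀ N, max K N0 ≤ N →
        ∑ j ∈ Finset.range (N+2), g j (t+h) - ∑ j ∈ Finset.range (N+2), g j t ≤ 2 * Rr * h := by
      intro N hN
      have hdiff : Differentiable ℝ (fun τ => ∑ j ∈ Finset.range (N+2), g j τ) :=
        fun τ => (hder (N+2) τ).differentiableAt
      have := (convex_Icc t (t+h)).image_sub_le_mul_sub_of_deriv_le
        hdiff.continuous.continuousOn hdiff.differentiableOn (C := 2 * Rr)
        (fun x hx => (hball (hin x (interior_subset hx))).2 N hN) t
        ⟨le_rfl, by linarith⟩ (t+h) ⟨by linarith, le_rfl⟩ (by linarith)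
      simpa using this
    have l1 := (hsum (t+h) (hball (hin (t+h) ⟨by linarith, le_rfl⟩)).1).hasSum.tendsto_sum_nat
    have l2 := (hsum t hpos).hasSum.tendsto_sum_nat
    rw [← hFg] at l1 l2
    have l3 := ((tendsto_add_atTop_iff_nat 2).2 l1).sub ((tendsto_add_atTop_iff_nat 2).2 l2)
    refine le_of_tendsto l3 ?_
    filter_upwards [eventually_ge_atTop (max K N0)] with N h using hN N h
  have hD2 : D ≤ 2 * Rr := by
    refine le_of_tendsto hD.tendsto_slope_zero_right ?_
    have : ∀ᶠ h in 𝓝[>] (0:ℝ), h < δ := (gt_mem_nhds hδ).filter_mono nhdsWithin_le_nhds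
    filter_upwards [this, self_mem_nhdsWithin] with h h1 h2
    have h2' : 0 < h := h2
    have := hinc h h2' h1
    rw [smul_eq_mul, inv_mul_le_iff₀ h2']
    linarith
  linarith

/-- the second ladder inequality
`(1/2) dH_n/dt ≤ -(ν/2) H_{n+1} + (d_n/ν) H_n sup_j|u_j|² + H_n^{1/2} Φ_n^{1/2}`. -/
theorem sabra_ladder_u (a b c ν k₀ lam : ℝ)
    (hν : 0 < ν) (hk₀ : 0 < k₀) (hlam : 1 < lam) (habc : a + b + c = 0)
    (n : ℕ) (f : ℕ → ℂ)
    (hΦ : Summable (fun j : ℕ => (wk k₀ lam (j+1))^(2*n) * ‖f (j+1)‖^2))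
    (u : ℕ → ℝ → ℂ)
    (hsol : IsSabraSolution a b c ν k₀ lam f u Set.univ)
    (t : ℝ) (D : ℝ)
    (hD : HasDerivAt (fun τ => HnS k₀ lam n (fun j => u j τ)) D t) :
    (1/2) * D ≤ -(ν/2 * HnS k₀ lam (n+1) (fun j => u j t))
      + (dnS a b lam n / ν) * HnS k₀ lam n (fun j => u j t)
          * (⨆ j : ℕ, ‖u (j+1) t‖^2)
      + Real.sqrt (HnS k₀ lam n (fun j => u j t)) * Real.sqrt (PhinS k₀ lam n f) := by
  have hl : 0 < lam := by linarith
  have hk := fun j => (wk_pos hk₀ hlam j)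
  have hnn : ∀ p τ, 0 ≤ HnS k₀ lam p (fun j => u j τ) := fun p τ =>
    tsum_nonneg fun j => mul_nonneg (pow_nonneg (hk _).le _) (sq_nonneg _)
  rcases (hnn n t).eq_or_lt with hz | hpos
  · have hD0 : D = 0 := by
      refine IsLocalMin.hasDerivAt_eq_zero (Filter.Eventually.of_forall fun τ => ?_) hD
      show HnS k₀ lam n (fun j => u j t) ≤ _
      rw [← hz]; exact hnn n τ
    have hz1 : HnS k₀ lam (n+1) (fun j => u j t) = 0 := by
      by_cases hs : Summable (fun j => wk k₀ lam (j+1) ^ (2*n) * ‖u (j+1) t‖^2)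
      · have h1 : ∀ j, wk k₀ lam (j+1) ^ (2*n) * ‖u (j+1) t‖^2 = 0 := by
          have := (hs.hasSum_iff.2 hz.symm)
          exact fun j => congrFun ((hasSum_zero_iff_of_nonneg
            (fun j => mul_nonneg (pow_nonneg (hk _).le _) (sq_nonneg _))).1 this) j
        have h2 : ∀ j, wk k₀ lam (j+1) ^ (2*(n+1)) * ‖u (j+1) t‖^2 = 0 := by
          intro j
          have : wk k₀ lam (j+1) ^ (2*(n+1)) * ‖u (j+1) t‖^2 =
            wk k₀ lam (j+1) ^ 2 * (wk k₀ lam (j+1) ^ (2*n) * ‖u (j+1) t‖^2) := by ring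
          rw [this, h1, mul_zero]
        simp only [HnS, h2, tsum_zero]
      · apply tsum_eq_zero_of_not_summable
        intro hs1
        apply hs
        refine Summable.of_nonneg_of_le
          (fun j => mul_nonneg (pow_nonneg (hk _).le _) (sq_nonneg _)) (fun j => ?_)
          (hs1.mul_left ((k₀^2)⁻¹))
        rw [le_inv_mul_iff₀ (by positivity)]
        have e : wk k₀ lam (j+1) ^ (2*(n+1)) * ‖u (j+1) t‖^2 =
            wk k₀ lam (j+1) ^ 2 * (wk k₀ lam (j+1) ^ (2*n) * ‖u (j+1) t‖^2) := by ring
        show _ ≤ wk k₀ lam (j+1) ^ (2*(n+1)) * ‖u (j+1) t‖^2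
        rw [e]
        have := wk_ge hk₀ hlam (j+1)
        have := hk (j+1)
        gcongr
    rw [← hz, hz1, hD0]; simp
  · set F := HnS k₀ lam n (fun j => u j t) with hF
    have hs : Summable (fun j => wk k₀ lam (j+1) ^ (2*n) * ‖u (j+1) t‖^2) := by
      by_contra hc
      have : F = 0 := tsum_eq_zero_of_not_summable hc
      linarith
    set M := (⨆ j : ℕ, ‖u (j+1) t‖^2) with hM
    have hbdd : BddAbove (Set.range fun j => ‖u (j+1) t‖^2) := by
      refine ⟨F / k₀^(2*n), ?_⟩
      rintro _ ⟨j, rfl⟩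
      show ‖u (j+1) t‖^2 ≤ _
      rw [le_div_iff₀ (by positivity)]
      have h1 : wk k₀ lam (j+1) ^ (2*n) * ‖u (j+1) t‖^2 ≤ F :=
        hs.le_tsum j (fun i _ => mul_nonneg (pow_nonneg (hk _).le _) (sq_nonneg _))
      have h2 : k₀ ^ (2*n) * ‖u (j+1) t‖^2 ≤ wk k₀ lam (j+1) ^ (2*n) * ‖u (j+1) t‖^2 := by
        have := wk_ge hk₀ hlam (j+1)
        gcongr
      linarith
    have hM0 : 0 ≤ M := Real.iSup_nonneg fun j => sq_nonneg _
    have hm : ∀ j, ‖u j t‖ ≤ √M := by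
      intro j
      rcases j with _ | j
      · rw [hsol.1 t, norm_zero]; exact Real.sqrt_nonneg _
      · exact Real.le_sqrt_of_sq_le (le_ciSup hbdd j)
    have hR : ∀ K : ℕ, (1/2) * D ≤
        - (ν/2) * (∑ j ∈ Finset.range K, wk k₀ lam (j+1) ^ (2*(n+1)) * ‖u (j+1) t‖ ^ 2)
        + (dnS a b lam n / ν) * F * M + √F * √(PhinS k₀ lam n f) := by
      intro K
      have hb := deriv_bound a b c ν k₀ lam hν hk₀ hlam n f hΦ u hsol t D hD hpos (√M) hm K
      rw [← hF] at hb
      set P := ∑ j ∈ Finset.range K, wk k₀ lam (j+1) ^ (2*(n+1)) * ‖u (j+1) t‖ ^ 2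
      set A := |a| * (lam^(2*n))⁻¹ + |b| + |c| * lam^(2*n) with hA
      have hcont : Continuous (fun ε : ℝ => - (ν/2) * (P - ε)
        + (A * ((√M + ε + ε / k₀^n) * ((lam ^ (n+1))⁻¹ * √(F + ε)
            + 2 * lam ^ (n+1) * ε)))^2 / (2 * ν) + √(F + ε) * √(PhinS k₀ lam n f)) := by
        fun_prop
      have hlim := (hcont.tendsto 0).mono_left (nhdsWithin_le_nhds (s := Set.Ioi 0))
      have h1 := ge_of_tendsto hlim (by
        filter_upwards [self_mem_nhdsWithin] with ε hε using hb ε hε)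
      refine h1.trans (le_of_eq ?_)
      have hc : |c| = |a + b| := by
        rw [show c = -(a+b) by linarith, abs_neg]
      have hcn : cnS a b lam n = lam^2 * ((lam^(n+1))⁻¹ * A) := by
        unfold cnS
        rw [hA, hc, zpow_sub₀ hl.ne', zpow_neg]
        have e : lam ^ (2 * (n:ℤ)) = lam ^ (2*n) := by
          rw [← zpow_natCast]; push_cast; rfl
        rw [e, zpow_one, zpow_natCast]
        field_simp
        ring
      have hd : dnS a b lam n = ((lam^(n+1))⁻¹ * A)^2 / 2 := by
        unfold dnS
        rw [hcn]
        field_simp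
      rw [hd]
      simp only [sub_zero, add_zero, zero_div, mul_zero]
      have s1 := Real.sq_sqrt hM0
      have s2 := Real.sq_sqrt hpos.le
      have : (A * (√M * ((lam^(n+1))⁻¹ * √F)))^2 / (2*ν) =
          ((lam^(n+1))⁻¹ * A)^2 / 2 / ν * F * M := by
        rw [show (A * (√M * ((lam^(n+1))⁻¹ * √F)))^2 = (A * (lam^(n+1))⁻¹)^2 * (√M)^2 * (√F)^2 by ring,
          s1, s2]
        field_simp
      rw [this]
    by_cases hs1 : Summable (fun j => wk k₀ lam (j+1) ^ (2*(n+1)) * ‖u (j+1) t‖^2)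
    · have l1 := hs1.hasSum.tendsto_sum_nat
      have l2 := ((l1.const_mul (-(ν/2))).add_const ((dnS a b lam n / ν) * F * M)).add_const
        (√F * √(PhinS k₀ lam n f))
      have := ge_of_tendsto' l2 hR
      rw [← neg_mul]
      exact this
    · have : HnS k₀ lam (n+1) (fun j => u j t) = 0 := tsum_eq_zero_of_not_summable hs1
      rw [this]
      have := hR 0
      simpa using this
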